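/- Canonical parametrization of the PD control system: let ξ¹, ξ² be smooth real functions on ℝ² and define η² = ∂₂∂₂ξ¹ + ∂₁∂₂ξ² − x²∂₂ξ² − 2ξ² and η¹ = ∂₁∂₂ξ¹ − x²∂₂ξ¹ + ξ¹ + ∂₁∂₁ξ² − 2x²∂₁ξ² + (x²)²ξ². Then ∂₂η¹ − ∂₁η² + x²η² = 0. -/

import Mathlib

/-- The partial derivative of `g : ℝ² → ℝ` with respect to the `i`-th coordinate. -/
noncomputable def pd (i : Fin 2) (g : (Fin 2 → ℝ) → ℝ) : (Fin 2 → ℝ) → ℝ :=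
  fun x => fderiv ℝ g x (Pi.single i 1)

theorem pd_smooth {f : (Fin 2 → ℝ) → ℝ} (hf : ContDiff ℝ (⊤ : ℕ∞) f) (i : Fin 2) :
    ContDiff ℝ (⊤ : ℕ∞) (pd i f) := by
  have h : ContDiff ℝ (⊤ : ℕ∞) (fderiv ℝ f) := hf.fderiv_right (by simp)
  exact h.clm_apply contDiff_const

theorem pd_comm {f : (Fin 2 → ℝ) → ℝ} (hf : ContDiff ℝ (⊤ : ℕ∞) f) (i j : Fin 2) :
    pd i (pd j f) = pd j (pd i f) := by
  have h : ContDiff ℝ (⊤ : ℕ∞) (fderiv ℝ f) := hf.fderiv_right (by simp)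
  have hd : Differentiable ℝ (fderiv ℝ f) := h.differentiable (by simp)
  have key : ∀ (a b : Fin 2) x, pd a (pd b f) x
      = fderiv ℝ (fderiv ℝ f) x (Pi.single a 1) (Pi.single b 1) := by
    intro a b x
    have := ((hd x).hasFDerivAt.clm_apply
      (hasFDerivAt_const (Pi.single b (1 : ℝ) : Fin 2 → ℝ) x)).fderiv
    unfold pd
    rw [this]
    simp
  funext x
  rw [key, key]
  have hs : IsSymmSndFDerivAt ℝ f x :=
    hf.contDiffAt.isSymmSndFDerivAt (by simp only [minSmoothness_of_isRCLikeNormedField]; exact WithTop.coe_le_coe.2 (le_top : (2 : ℕ∞) ≤ ⊤))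
  exact hs _ _

theorem pd_add {f g : (Fin 2 → ℝ) → ℝ} (hf : ContDiff ℝ (⊤ : ℕ∞) f)
    (hg : ContDiff ℝ (⊤ : ℕ∞) g) (i : Fin 2) (x : Fin 2 → ℝ) :
    pd i (fun x => f x + g x) x = pd i f x + pd i g x := by
  have := ((hf.differentiable (by simp) x).hasFDerivAt.add
    (hg.differentiable (by simp) x).hasFDerivAt).fderiv
  exact congrArg (fun L => L (Pi.single i 1)) this

theorem pd_sub {f g : (Fin 2 → ℝ) → ℝ} (hf : ContDiff ℝ (⊤ : ℕ∞) f)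
    (hg : ContDiff ℝ (⊤ : ℕ∞) g) (i : Fin 2) (x : Fin 2 → ℝ) :
    pd i (fun x => f x - g x) x = pd i f x - pd i g x := by
  have := ((hf.differentiable (by simp) x).hasFDerivAt.sub
    (hg.differentiable (by simp) x).hasFDerivAt).fderiv
  exact congrArg (fun L => L (Pi.single i 1)) this

theorem pd_mul {f g : (Fin 2 → ℝ) → ℝ} (hf : ContDiff ℝ (⊤ : ℕ∞) f)
    (hg : ContDiff ℝ (⊤ : ℕ∞) g) (i : Fin 2) (x : Fin 2 → ℝ) :
    pd i (fun x => f x * g x) x = f x * pd i g x + g x * pd i f x := by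
  have := ((hf.differentiable (by simp) x).hasFDerivAt.mul
    (hg.differentiable (by simp) x).hasFDerivAt).fderiv
  exact congrArg (fun L => L (Pi.single i 1)) this

theorem pd_const (c : ℝ) (i : Fin 2) (x : Fin 2 → ℝ) : pd i (fun _ => c) x = 0 := by
  simp [pd]

theorem pd_coord (i : Fin 2) (x : Fin 2 → ℝ) :
    pd i (fun x => x 1) x = (Pi.single i 1 : Fin 2 → ℝ) 1 := by
  have := (hasFDerivAt_apply (𝕜 := ℝ) (1 : Fin 2) x).fderiv
  exact congrArg (fun L => L (Pi.single i 1)) this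

/-- Canonical parametrization of the PD control system: for smooth
`ξ¹, ξ² : ℝ² → ℝ`, the functions
`η² = ∂₂∂₂ξ¹ + ∂₁∂₂ξ² − x²∂₂ξ² − 2ξ²` and
`η¹ = ∂₁∂₂ξ¹ − x²∂₂ξ¹ + ξ¹ + ∂₁∂₁ξ² − 2x²∂₁ξ² + (x²)²ξ²`
satisfy `∂₂η¹ − ∂₁η² + x²η² = 0`. -/
theorem canonical_parametrization (ξ1 ξ2 η1 η2 : (Fin 2 → ℝ) → ℝ)
    (hξ1 : ContDiff ℝ (⊤ : ℕ∞) ξ1) (hξ2 : ContDiff ℝ (⊤ : ℕ∞) ξ2)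
    (hη2 : η2 = fun x =>
      pd 1 (pd 1 ξ1) x + pd 0 (pd 1 ξ2) x - x 1 * pd 1 ξ2 x - 2 * ξ2 x)
    (hη1 : η1 = fun x =>
      pd 0 (pd 1 ξ1) x - x 1 * pd 1 ξ1 x + ξ1 x + pd 0 (pd 0 ξ2) x
        - 2 * x 1 * pd 0 ξ2 x + (x 1) ^ 2 * ξ2 x) :
    ∀ x, pd 1 η1 x - pd 0 η2 x + x 1 * η2 x = 0 := by
  have y : ContDiff ℝ (⊤ : ℕ∞) (fun x : Fin 2 → ℝ => x 1) := contDiff_apply ℝ ℝ (1 : Fin 2)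
  have c : ContDiff ℝ (⊤ : ℕ∞) (fun _ : Fin 2 → ℝ => (2 : ℝ)) := contDiff_const
  have a1 := pd_smooth hξ1 1
  have a11 := pd_smooth a1 1
  have a01 := pd_smooth a1 0
  have b0 := pd_smooth hξ2 0
  have b1 := pd_smooth hξ2 1
  have b00 := pd_smooth b0 0
  have b01 := pd_smooth b1 0
  intro x
  have e1 : pd 1 η1 x = pd 1 (pd 0 (pd 1 ξ1)) x - (x 1 * pd 1 (pd 1 ξ1) x + pd 1 ξ1 x)
      + pd 1 ξ1 x + pd 1 (pd 0 (pd 0 ξ2)) x - (2 * x 1 * pd 1 (pd 0 ξ2) x + pd 0 ξ2 x * 2)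
      + (x 1 * x 1 * pd 1 ξ2 x + ξ2 x * (2 * x 1)) := by
    simp only [hη1, pow_two]
    rw [pd_add (((((a01.sub (y.mul a1)).add hξ1).add b00).sub ((c.mul y).mul b0)))
        ((y.mul y).mul hξ2),
      pd_sub ((((a01.sub (y.mul a1)).add hξ1).add b00)) ((c.mul y).mul b0),
      pd_add ((a01.sub (y.mul a1)).add hξ1) b00, pd_add (a01.sub (y.mul a1)) hξ1,
      pd_sub a01 (y.mul a1), pd_mul y a1, pd_mul (c.mul y) b0, pd_mul c y,
      pd_mul (y.mul y) hξ2, pd_mul y y, pd_const, pd_coord]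
    simp only [Pi.single_eq_same]
    ring
  have e2 : pd 0 η2 x = pd 0 (pd 1 (pd 1 ξ1)) x + pd 0 (pd 0 (pd 1 ξ2)) x
      - x 1 * pd 0 (pd 1 ξ2) x - 2 * pd 0 ξ2 x := by
    simp only [hη2]
    rw [pd_sub ((a11.add b01).sub (y.mul b1)) (c.mul hξ2), pd_sub (a11.add b01) (y.mul b1),
      pd_add a11 b01, pd_mul y b1, pd_mul c hξ2, pd_const, pd_coord]
    simp
  rw [e1, e2, hη2, pd_comm a1 1 0, pd_comm b0 1 0, pd_comm hξ2 1 0]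
  ring
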